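/- There is a constant C > 0 such that for every ω ≥ 1 and every Schwartz function f on ℝ³ = ℝ² × ℝ (variables (x,z)) satisfying the orthogonality condition ∫_ℝ f(x,z) h_ω(z) dz = 0 for every x ∈ ℝ², one has ‖f − Δf‖_{L²(ℝ³)} ≤ C ‖S²f‖_{L²(ℝ³)}, where S²f = (1−ω) f − Δ f + ω² z² f. -/

import Mathlib

open MeasureTheory Complex

noncomputable section

/-- ℝ² with the Euclidean norm. -/
abbrev R2 : Type := EuclideanSpace ℝ (Fin 2)

/-- ℝ³ written as ℝ² × ℝ, points r = (x, z). -/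
abbrev R3 : Type := R2 × ℝ

/-- Directional derivative of `f` at `p` in the direction `v`. -/
def pd {E F : Type*} [NormedAddCommGroup E] [NormedSpace ℝ E]
    [NormedAddCommGroup F] [NormedSpace ℝ F] (v : E) (f : E → F) (p : E) : F :=
  fderiv ℝ f p v

/-- Second directional derivative in the direction `v`. -/
def pd2 {E F : Type*} [NormedAddCommGroup E] [NormedSpace ℝ E]
    [NormedAddCommGroup F] [NormedSpace ℝ F] (v : E) (f : E → F) (p : E) : F :=
  pd v (pd v f) p

/-- First coordinate direction in the x-plane. -/
def ex0 : R3 := (EuclideanSpace.single 0 1, 0)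

/-- Second coordinate direction in the x-plane. -/
def ex1 : R3 := (EuclideanSpace.single 1 1, 0)

/-- The z-direction. -/
def ez : R3 := (0, 1)

/-- The full Laplacian on ℝ³ = ℝ² × ℝ. -/
def lap3 {F : Type*} [NormedAddCommGroup F] [NormedSpace ℝ F]
    (f : R3 → F) (p : R3) : F :=
  pd2 ex0 f p + pd2 ex1 f p + pd2 ez f p

/-- The operator `S² f = (1−ω)f − Δf + ω² z² f` on functions on ℝ³. -/
def S2op (ω : ℝ) (f : R3 → ℂ) (p : R3) : ℂ :=
  ((1 - ω : ℝ) : ℂ) * f p - lap3 f p + ((ω ^ 2 * p.2 ^ 2 : ℝ) : ℂ) * f p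
/-- Normalized ground state `h_ω(z) = ω^{1/4} π^{-1/4} e^{-ωz²/2}` of `−∂_z² + ω²z²`. -/
def hosc (ω z : ℝ) : ℝ :=
  ω ^ ((1 : ℝ) / 4) * Real.pi ^ (-(1 : ℝ) / 4) * Real.exp (-(ω * z ^ 2) / 2)

open Set Filter Topology in
/-- The tail bound `∫_z^∞ e^{-ωs²/2} |g(s)| ds ≤ K e^{-ωz²/2} / (ωz)` when `|g| ≤ K`. -/
lemma norm_integral_Ioi_gaussian_mul_le {ω K z : ℝ} (hω : 0 < ω) (hz : 0 < z) {g : ℝ → ℂ}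
    (hg : ∀ s, ‖g s‖ ≤ K) :
    ‖∫ s in Ioi z, Real.exp (-(ω * s ^ 2) / 2) • g s‖ ≤
      K / (ω * z) * Real.exp (-(ω * z ^ 2) / 2) := by
  have hK : 0 ≤ K := (norm_nonneg _).trans (hg 0)
  have hderiv : ∀ x ∈ Ici z, HasDerivAt
      (fun s => -(K / (ω * z)) * Real.exp (-(ω * s ^ 2) / 2))
      (K / z * (x * Real.exp (-(ω * x ^ 2) / 2))) x := by
    intro x _
    have h1 : HasDerivAt (fun s : ℝ => -(ω * s ^ 2) / 2) (-(ω * x)) x := by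
      refine ((((hasDerivAt_pow 2 x).const_mul ω).neg).div_const 2).congr_deriv ?_
      push_cast; ring
    refine ((h1.exp).const_mul (-(K / (ω * z)))).congr_deriv ?_
    field_simp
  have hlim : Tendsto (fun s => -(K / (ω * z)) * Real.exp (-(ω * s ^ 2) / 2)) atTop (𝓝 0) := by
    have h : Tendsto (fun s : ℝ => (ω / 2) * s ^ 2) atTop atTop :=
      (tendsto_pow_atTop two_ne_zero).const_mul_atTop (by positivity)
    have h2 := (Real.tendsto_exp_neg_atTop_nhds_zero.comp h).const_mul (-(K / (ω * z)))
    rw [mul_zero] at h2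
    refine h2.congr fun s => ?_
    simp only [Function.comp]
    congr 2; ring
  have hint : IntegrableOn (fun x => K / z * (x * Real.exp (-(ω * x ^ 2) / 2))) (Ioi z) :=
    integrableOn_Ioi_deriv_of_nonneg' hderiv
      (fun x hx => by have : 0 < x := hz.trans hx; positivity) hlim
  calc _ ≤ ∫ s in Ioi z, K / z * (s * Real.exp (-(ω * s ^ 2) / 2)) := by
        refine norm_integral_le_of_norm_le hint ?_
        filter_upwards [ae_restrict_mem measurableSet_Ioi] with s hs
        rw [norm_smul, Real.norm_eq_abs, abs_of_pos (Real.exp_pos _)]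
        have h1 : 1 ≤ s / z := (one_le_div hz).2 (le_of_lt hs)
        calc _ ≤ Real.exp (-(ω * s ^ 2) / 2) * K := by gcongr; exact hg s
          _ ≤ Real.exp (-(ω * s ^ 2) / 2) * K * (s / z) :=
            le_mul_of_one_le_right (by positivity) h1
          _ = _ := by ring
    _ = _ := by
        rw [integral_Ioi_of_hasDerivAt_of_tendsto' hderiv hint hlim]; ring

open Set in
/-- Antiderivatives: `z ↦ ∫_{-∞}^z F` has derivative `F`. -/
lemma hasDerivAt_integral_Iic {F : ℝ → ℂ} (hc : Continuous F) (hF : Integrable F) (z : ℝ) :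
    HasDerivAt (fun t => ∫ s in Iic t, F s) (F z) z := by
  have h : (fun t => ∫ s in Iic t, F s) =
      fun t => (∫ s in Iic (0 : ℝ), F s) + ∫ s in (0 : ℝ)..t, F s := by
    funext t
    rw [← intervalIntegral.integral_Iic_sub_Iic hF.integrableOn hF.integrableOn]
    ring
  rw [h]
  exact (intervalIntegral.integral_hasDerivAt_right (hc.intervalIntegrable _ _)
    (hc.stronglyMeasurableAtFilter _ _) hc.continuousAt).const_add _

open Set Filter Topology in
/-- A spectral gap for the harmonic oscillator above its ground state: if `g ⟂ h_ω` then
`ω ‖g‖² ≤ ‖g' + ω z g‖²`. -/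
lemma harmonic_gap {ω : ℝ} (hω : 0 < ω) (g b : SchwartzMap ℝ ℂ)
    (hb : ∀ z, b z = deriv g z + (ω * z) • g z)
    (h0 : ∫ s, Real.exp (-(ω * s ^ 2) / 2) • g s = 0) :
    ω * ∫ z, ‖g z‖ ^ 2 ≤ ∫ z, ‖b z‖ ^ 2 := by
  set K := SchwartzMap.seminorm ℝ 0 0 g
  have hK : ∀ s, ‖g s‖ ≤ K := g.norm_le_seminorm ℝ
  set F : ℝ → ℂ := fun s => Real.exp (-(ω * s ^ 2) / 2) • g s with hFdef
  have hFc : Continuous F := by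
    have := g.continuous
    fun_prop
  have hFi : Integrable F := by
    refine g.integrable.mono hFc.aestronglyMeasurable (.of_forall fun s => ?_)
    rw [norm_smul, Real.norm_eq_abs, abs_of_pos (Real.exp_pos _)]
    refine mul_le_of_le_one_left (norm_nonneg _) (Real.exp_le_one_iff.2 ?_)
    have : 0 ≤ ω * s ^ 2 := by positivity
    linarith
  set G : ℝ → ℂ := fun t => ∫ s in Iic t, F s
  have hG : ∀ z, HasDerivAt G (F z) z := hasDerivAt_integral_Iic hFc hFi
  have hGbound : ∀ z, z ≠ 0 → ‖G z‖ ≤ K / (ω * |z|) * Real.exp (-(ω * z ^ 2) / 2) := by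
    intro z hz
    rcases hz.lt_or_gt with hz | hz
    · have h1 : G z = ∫ s in Ioi (-z), Real.exp (-(ω * s ^ 2) / 2) • g (-s) := by
        rw [← integral_comp_neg_Iic]
        simp [G, F]
      rw [h1, abs_of_neg hz]
      simpa using norm_integral_Ioi_gaussian_mul_le hω (neg_pos.2 hz) (g := fun s => g (-s))
        (fun s => hK _)
    · have h1 : G z = -∫ s in Ioi z, F s := by
        rw [eq_neg_iff_add_eq_zero, intervalIntegral.integral_Iic_add_Ioi hFi.integrableOn
          hFi.integrableOn, h0]
      rw [h1, norm_neg, abs_of_pos hz]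
      exact norm_integral_Ioi_gaussian_mul_le hω hz hK
  set φ : ℝ → ℂ := fun z => -(Real.exp (ω * z ^ 2 / 2) • G z)
  have hφ : ∀ z, HasDerivAt φ ((ω * z) • φ z - g z) z := by
    intro z
    have h1 : HasDerivAt (fun s : ℝ => ω * s ^ 2 / 2) (ω * z) z := by
      refine (((hasDerivAt_pow 2 z).const_mul ω).div_const 2).congr_deriv ?_
      push_cast; ring
    refine (h1.exp.smul (hG z)).neg.congr_deriv ?_
    simp only [φ, hFdef, smul_smul, ← Real.exp_add]
    rw [show ω * z ^ 2 / 2 + -(ω * z ^ 2) / 2 = 0 by ring, Real.exp_zero, one_smul, smul_neg,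
      smul_smul, mul_comm (ω * z)]
    abel
  have hφbound : ∀ z, z ≠ 0 → ‖φ z‖ ≤ K / (ω * |z|) := by
    intro z hz
    rw [norm_neg, norm_smul, Real.norm_eq_abs, abs_of_pos (Real.exp_pos _)]
    calc _ ≤ Real.exp (ω * z ^ 2 / 2) * (K / (ω * |z|) * Real.exp (-(ω * z ^ 2) / 2)) := by
          gcongr; exact hGbound z hz
      _ = K / (ω * |z|) * Real.exp (ω * z ^ 2 / 2 + -(ω * z ^ 2) / 2) := by
          rw [Real.exp_add]; ring
      _ = _ := by
          rw [show ω * z ^ 2 / 2 + -(ω * z ^ 2) / 2 = 0 by ring, Real.exp_zero, mul_one]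
  -- the boundary term
  set Q : ℝ → ℝ := fun z => 2 * ω * inner ℝ (g z) (φ z) - ω ^ 2 * (z * ‖φ z‖ ^ 2)
  set Q' : ℝ → ℝ := fun z => 2 * ω * (inner ℝ (g z) ((ω * z) • φ z - g z) +
    inner ℝ (deriv g z) (φ z)) - ω ^ 2 * (1 * ‖φ z‖ ^ 2 +
      z * (2 * inner ℝ (φ z) ((ω * z) • φ z - g z)))
  have hQ : ∀ z, HasDerivAt Q (Q' z) z := fun z =>
    (((g.hasDerivAt z).inner ℝ (hφ z)).const_mul (2 * ω)).sub
      (((hasDerivAt_id z).mul (hφ z).norm_sq).const_mul (ω ^ 2))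
  have hQ' : ∀ z, Q' z ≤ ‖b z‖ ^ 2 - ω * ‖g z‖ ^ 2 := by
    intro z
    have h1 : 0 ≤ ‖b z - ω • φ z‖ ^ 2 := by positivity
    have h2 : 0 ≤ ‖(ω * z) • φ z - g z‖ ^ 2 := by positivity
    rw [hb] at h1 ⊢
    simp only [Q', ← real_inner_self_eq_norm_sq, inner_add_left, inner_add_right, inner_sub_left,
      inner_sub_right, real_inner_smul_left, real_inner_smul_right,
      real_inner_comm (deriv g z) (g z), real_inner_comm (φ z) (g z),
      real_inner_comm (φ z) (deriv g z)] at h1 h2 ⊢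
    have h3 : 0 ≤ ω * ((ω * z) ^ 2 * inner ℝ (φ z) (φ z)) := by
      have := real_inner_self_nonneg (x := φ z)
      positivity
    nlinarith [mul_nonneg hω.le h2]
  have hQbound : ∀ z, z ≠ 0 → ‖Q z‖ ≤ 3 * K ^ 2 / |z| := by
    intro z hz
    have hz' : 0 < |z| := abs_pos.2 hz
    have hK0 : 0 ≤ K := (norm_nonneg _).trans (hK 0)
    have h1 := hφbound z hz
    calc ‖Q z‖ ≤ ‖2 * ω * inner ℝ (g z) (φ z)‖ + ‖ω ^ 2 * (z * ‖φ z‖ ^ 2)‖ := norm_sub_le _ _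
      _ ≤ 2 * ω * (K * (K / (ω * |z|))) + ω ^ 2 * (|z| * (K / (ω * |z|)) ^ 2) := by
          rw [norm_mul, norm_mul (ω ^ 2), norm_mul z]
          simp only [Real.norm_eq_abs, abs_pow, abs_mul, abs_norm, abs_of_pos hω, Nat.abs_ofNat]
          gcongr
          exact (abs_real_inner_le_norm _ _).trans (by gcongr; exact hK z)
      _ = _ := by field_simp; ring
  have hlimR : Tendsto (fun R : ℝ => 3 * K ^ 2 / |R|) atTop (𝓝 0) :=
    tendsto_const_nhds.div_atTop tendsto_abs_atTop_atTop
  have hQtop : Tendsto Q atTop (𝓝 0) := by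
    refine squeeze_zero_norm' ?_ hlimR
    filter_upwards [eventually_ne_atTop 0] with R hR using hQbound R hR
  have hQbot : Tendsto (fun R => Q (-R)) atTop (𝓝 0) := by
    refine squeeze_zero_norm' ?_ hlimR
    filter_upwards [eventually_ne_atTop 0] with R hR
    simpa using hQbound (-R) (neg_ne_zero.2 hR)
  have hgi : Integrable (fun z => ‖g z‖ ^ 2) := (g.memLp 2).integrable_norm_pow two_ne_zero
  have hbi : Integrable (fun z => ‖b z‖ ^ 2) := (b.memLp 2).integrable_norm_pow two_ne_zero
  have hui : Integrable (fun z => ‖b z‖ ^ 2 - ω * ‖g z‖ ^ 2) := hbi.sub (hgi.const_mul ω)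
  have key : (0 : ℝ) - 0 ≤ ∫ z, (‖b z‖ ^ 2 - ω * ‖g z‖ ^ 2) := by
    refine le_of_tendsto_of_tendsto (hQtop.sub hQbot)
      (intervalIntegral_tendsto_integral hui tendsto_neg_atTop_atBot tendsto_id) ?_
    filter_upwards [eventually_ge_atTop 0] with R hR
    exact intervalIntegral.sub_le_integral_of_hasDeriv_right_of_le (by simp; linarith)
      (fun z _ => (hQ z).continuousAt.continuousWithinAt) (fun z _ => (hQ z).hasDerivWithinAt)
      hui.integrableOn (fun z _ => hQ' z)
  rw [integral_sub hbi (hgi.const_mul ω), integral_const_mul] at key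
  linarith

/-- The algebra behind the bound: `D₀, D₁, D` are skew-symmetric, `Z` is symmetric and
`[D, Z] = 1` while `D₀, D₁` commute with `Z`. A spectral gap for `(D + ωZ)* (D + ωZ)` at `f`
controls `f - Δf` by `S²f`. -/
lemma norm_sub_laplacian_le_of_gap {W H : Type*} [AddCommGroup W] [Module ℝ W]
    [NormedAddCommGroup H] [InnerProductSpace ℝ H] (ι : W →ₗ[ℝ] H) (D₀ D₁ D Z : W →ₗ[ℝ] W)
    (h₀ : ∀ f g, inner ℝ (ι f) (ι (D₀ g)) = -inner ℝ (ι (D₀ f)) (ι g))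
    (h₁ : ∀ f g, inner ℝ (ι f) (ι (D₁ g)) = -inner ℝ (ι (D₁ f)) (ι g))
    (hD : ∀ f g, inner ℝ (ι f) (ι (D g)) = -inner ℝ (ι (D f)) (ι g))
    (hZ : ∀ f g, inner ℝ (ι f) (ι (Z g)) = inner ℝ (ι (Z f)) (ι g))
    (c₀ : ∀ f, D₀ (Z f) = Z (D₀ f)) (c₁ : ∀ f, D₁ (Z f) = Z (D₁ f))
    (c : ∀ f, D (Z f) = Z (D f) + f) {ω : ℝ} (hω : 0 ≤ ω) (f : W)
    (gap : ω * ‖ι f‖ ^ 2 ≤ ‖ι (D f + ω • Z f)‖ ^ 2) :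
    ‖ι (f - (D₀ (D₀ f) + D₁ (D₁ f) + D (D f)))‖ ≤
      3 * ‖ι ((1 - ω) • f - (D₀ (D₀ f) + D₁ (D₁ f) + D (D f)) + ω ^ 2 • Z (Z f))‖ := by
  set T := f - (D₀ (D₀ f) + D₁ (D₁ f) + D (D f)) with hT
  set S := (1 - ω) • f - (D₀ (D₀ f) + D₁ (D₁ f) + D (D f)) + ω ^ 2 • Z (Z f) with hS
  have hST : ι S = ι T - ω • ι f + ω ^ 2 • ι (Z (Z f)) := by
    rw [hS, hT]; simp only [map_add, map_sub, map_smul]; module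
  have hDZ : inner ℝ (ι (D f)) (ι (Z f)) = -(‖ι f‖ ^ 2) / 2 := by
    have h := hD f (Z f)
    rw [c, map_add, inner_add_right, hZ, real_inner_self_eq_norm_sq,
      real_inner_comm] at h
    linarith
  -- expectation of `T` in the state `f`
  have hTf : inner ℝ (ι T) (ι f) =
      ‖ι f‖ ^ 2 + ‖ι (D₀ f)‖ ^ 2 + ‖ι (D₁ f)‖ ^ 2 + ‖ι (D f)‖ ^ 2 := by
    rw [real_inner_comm, hT]
    simp only [map_add, map_sub, inner_sub_right, inner_add_right]
    rw [h₀, h₁, hD]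
    simp only [real_inner_self_eq_norm_sq]
    ring
  have hZZ : inner ℝ (ι (Z (Z f))) (ι f) = ‖ι (Z f)‖ ^ 2 := by
    rw [← hZ, real_inner_self_eq_norm_sq]
  have hcoer : ω * ‖ι f‖ ^ 2 ≤ inner ℝ (ι S) (ι f) := by
    rw [hST, inner_add_left, inner_sub_left, real_inner_smul_left, real_inner_smul_left, hTf, hZZ,
      real_inner_self_eq_norm_sq]
    rw [map_add, map_smul, norm_add_sq_real, real_inner_smul_right, hDZ, norm_smul, mul_pow,
      Real.norm_eq_abs, sq_abs] at gap
    nlinarith [sq_nonneg ‖ι f‖, sq_nonneg ‖ι (D₀ f)‖, sq_nonneg ‖ι (D₁ f)‖]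
  have hωf : ω * ‖ι f‖ ≤ ‖ι S‖ := by
    rcases (norm_nonneg (ι f)).eq_or_lt with h | h
    · rw [← h]; simp
    · refine le_of_mul_le_mul_right ?_ h
      calc _ = ω * ‖ι f‖ ^ 2 := by ring
        _ ≤ _ := hcoer.trans (real_inner_le_norm _ _)
  have hTZ : -(‖ι f‖ ^ 2) ≤ inner ℝ (ι T) (ι (Z (Z f))) := by
    have e₀ : inner ℝ (ι (Z (Z f))) (ι (D₀ (D₀ f))) = -‖ι (Z (D₀ f))‖ ^ 2 := by
      rw [h₀, c₀, c₀, ← hZ, real_inner_self_eq_norm_sq]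
    have e₁ : inner ℝ (ι (Z (Z f))) (ι (D₁ (D₁ f))) = -‖ι (Z (D₁ f))‖ ^ 2 := by
      rw [h₁, c₁, c₁, ← hZ, real_inner_self_eq_norm_sq]
    have e : inner ℝ (ι (Z (Z f))) (ι (D (D f))) = -‖ι (Z (D f))‖ ^ 2 + ‖ι f‖ ^ 2 := by
      rw [hD, c, c]
      simp only [map_add, inner_add_left]
      rw [← hZ, real_inner_self_eq_norm_sq, ← hZ, real_inner_comm, ← hZ, hDZ]
      ring
    rw [real_inner_comm, hT]
    simp only [map_add, map_sub, inner_sub_right, inner_add_right, e₀, e₁, e, hZZ]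
    nlinarith [sq_nonneg ‖ι (Z f)‖, sq_nonneg ‖ι (Z (D₀ f))‖, sq_nonneg ‖ι (Z (D₁ f))‖,
      sq_nonneg ‖ι (Z (D f))‖]
  have hsum : ‖ι T + ω ^ 2 • ι (Z (Z f))‖ ≤ 2 * ‖ι S‖ := by
    have : ι T + ω ^ 2 • ι (Z (Z f)) = ι S + ω • ι f := by rw [hST]; abel
    rw [this]
    refine (norm_add_le _ _).trans ?_
    rw [norm_smul, Real.norm_eq_abs, abs_of_nonneg hω]
    linarith
  have hsq := pow_le_pow_left₀ (norm_nonneg _) hsum 2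
  rw [norm_add_sq_real, real_inner_smul_right] at hsq
  have hωf2 := pow_le_pow_left₀ (by positivity) hωf 2
  refine abs_le_of_sq_le_sq' ?_ (by positivity) |>.2
  nlinarith [sq_nonneg ‖ω ^ 2 • ι (Z (Z f))‖, mul_le_mul_of_nonneg_left hTZ (sq_nonneg ω),
    sq_nonneg ‖ι S‖]

section

open LineDeriv

/-- The real `L²` inner product of Schwartz functions. -/
lemma SchwartzMap.real_inner_toL2_eq {E : Type*} [NormedAddCommGroup E] [NormedSpace ℝ E]
    [MeasurableSpace E] [BorelSpace E] [SecondCountableTopology E] (μ : Measure E)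
    [μ.HasTemperateGrowth] (f g : SchwartzMap E ℂ) :
    inner ℝ (f.toLp 2 μ) (g.toLp 2 μ) = ∫ x, inner ℝ (f x) (g x) ∂μ := by
  rw [L2.inner_def]
  apply integral_congr_ae
  filter_upwards [f.coeFn_toLp 2 μ, g.coeFn_toLp 2 μ] with _ hf hg
  rw [hf, hg]

lemma SchwartzMap.norm_toL2_sq {E : Type*} [NormedAddCommGroup E] [NormedSpace ℝ E]
    [MeasurableSpace E] [BorelSpace E] [SecondCountableTopology E] (μ : Measure E)
    [μ.HasTemperateGrowth] (f : SchwartzMap E ℂ) :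
    ‖f.toLp 2 μ‖ ^ 2 = ∫ x, ‖f x‖ ^ 2 ∂μ := by
  rw [← real_inner_self_eq_norm_sq, SchwartzMap.real_inner_toL2_eq]
  simp only [real_inner_self_eq_norm_sq]

lemma SchwartzMap.real_inner_toL2_lineDerivOp {E : Type*} [NormedAddCommGroup E]
    [NormedSpace ℝ E] [FiniteDimensional ℝ E] [MeasurableSpace E] [BorelSpace E] (μ : Measure E)
    [μ.IsAddHaarMeasure] (v : E) (f g : SchwartzMap E ℂ) :
    inner ℝ (f.toLp 2 μ) ((∂_{v} g).toLp 2 μ) = -inner ℝ ((∂_{v} f).toLp 2 μ) (g.toLp 2 μ) := by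
  rw [SchwartzMap.real_inner_toL2_eq, SchwartzMap.real_inner_toL2_eq]
  exact SchwartzMap.integral_bilinear_lineDerivOp_right_eq_neg_left f g (innerSL ℝ) v

instance isAddHaarMeasure_volume_R3 : (volume : Measure R3).IsAddHaarMeasure :=
  inferInstanceAs ((volume : Measure R2).prod (volume : Measure ℝ)).IsAddHaarMeasure

lemma hasTemperateGrowth_snd : (fun p : R3 => p.2).HasTemperateGrowth :=
  (ContinuousLinearMap.snd ℝ R2 ℝ).hasTemperateGrowth

/-- Multiplication by `z` on Schwartz functions. -/
def mulZ : SchwartzMap R3 ℂ →L[ℝ] SchwartzMap R3 ℂ :=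
  SchwartzMap.smulLeftCLM ℂ (fun p : R3 => p.2)

lemma mulZ_apply (f : SchwartzMap R3 ℂ) (p : R3) : mulZ f p = p.2 • f p :=
  SchwartzMap.smulLeftCLM_apply_apply hasTemperateGrowth_snd f p

lemma lineDerivOp_mulZ (v : R3) (f : SchwartzMap R3 ℂ) :
    ∂_{v} (mulZ f) = mulZ (∂_{v} f) + v.2 • f := by
  ext p
  have h : HasFDerivAt (mulZ f) (p.2 • fderiv ℝ f p +
      (ContinuousLinearMap.snd ℝ R2 ℝ).smulRight (f p)) p := by
    have := ((ContinuousLinearMap.snd ℝ R2 ℝ).hasFDerivAt (x := p)).smul (f.hasFDerivAt p)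
    refine this.congr_of_eventuallyEq (.of_forall fun q => mulZ_apply f q)
  rw [SchwartzMap.lineDerivOp_apply_eq_fderiv, h.fderiv]
  simp [mulZ_apply, SchwartzMap.lineDerivOp_apply_eq_fderiv]

lemma real_inner_toL2_mulZ (f g : SchwartzMap R3 ℂ) :
    inner ℝ (f.toLp 2 (volume : Measure R3)) ((mulZ g).toLp 2 (volume : Measure R3)) =
      inner ℝ ((mulZ f).toLp 2 (volume : Measure R3)) (g.toLp 2 (volume : Measure R3)) := by
  rw [SchwartzMap.real_inner_toL2_eq, SchwartzMap.real_inner_toL2_eq]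
  simp only [mulZ_apply, real_inner_smul_left, real_inner_smul_right]

/-- The restriction of a Schwartz function to a vertical line. -/
def vslice (x : R2) : SchwartzMap R3 ℂ →L[ℝ] SchwartzMap ℝ ℂ :=
  SchwartzMap.compCLMOfAntilipschitz ℝ (K := 1) (g := fun z : ℝ => (x, z))
    (by
      have h := ((ContinuousLinearMap.inr ℝ R2 ℝ).hasTemperateGrowth).add
        (Function.HasTemperateGrowth.const ((x, 0) : R3))
      convert h using 1
      ext z <;> simp)
    (AntilipschitzWith.of_le_mul_dist fun a b => by simp [Prod.dist_eq])

lemma vslice_apply (x : R2) (f : SchwartzMap R3 ℂ) (z : ℝ) : vslice x f z = f (x, z) := rfl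

lemma deriv_vslice (x : R2) (f : SchwartzMap R3 ℂ) (z : ℝ) :
    deriv (vslice x f) z = ∂_{ez} f (x, z) := by
  have h : HasDerivAt (fun z : ℝ => (x, z)) ez z := (hasDerivAt_const z x).prodMk (hasDerivAt_id z)
  exact ((f.hasFDerivAt (x, z)).comp_hasDerivAt z h).deriv

/-- The spectral gap, integrated over `x`. -/
lemma schwartz_gap {ω : ℝ} (hω : 0 < ω) (f : SchwartzMap R3 ℂ)
    (h0 : ∀ x : R2, (∫ z : ℝ, f (x, z) * (hosc ω z : ℂ)) = 0) :
    ω * ‖f.toLp 2 (volume : Measure R3)‖ ^ 2 ≤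
      ‖(∂_{ez} f + ω • mulZ f).toLp 2 (volume : Measure R3)‖ ^ 2 := by
  set b := ∂_{ez} f + ω • mulZ f with hb
  have hi : ∀ u : SchwartzMap R3 ℂ, Integrable (fun p : R3 => ‖u p‖ ^ 2)
      ((volume : Measure R2).prod (volume : Measure ℝ)) := fun u =>
    (u.memLp 2 (volume : Measure R3)).integrable_norm_pow two_ne_zero
  rw [SchwartzMap.norm_toL2_sq, SchwartzMap.norm_toL2_sq, Measure.volume_eq_prod,
    integral_prod _ (hi f), integral_prod _ (hi b), ← integral_const_mul]
  refine integral_mono ((hi f).integral_prod_left.const_mul ω) (hi b).integral_prod_left fun x => ?_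
  refine harmonic_gap hω (vslice x f) (vslice x b) (fun z => ?_) ?_
  · rw [deriv_vslice]
    simp [vslice_apply, hb, mulZ_apply, mul_assoc]
  · have hne : ((ω ^ ((1 : ℝ) / 4) * Real.pi ^ (-(1 : ℝ) / 4) : ℝ) : ℂ) ≠ 0 := by
      have := Real.pi_pos
      exact_mod_cast (by positivity : ω ^ ((1 : ℝ) / 4) * Real.pi ^ (-(1 : ℝ) / 4) ≠ 0)
    refine (mul_eq_zero.1 ?_).resolve_left hne
    rw [← integral_const_mul, ← h0 x]
    congr 1; funext z
    simp only [vslice_apply, hosc, Complex.real_smul]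
    push_cast; ring

/-- The bound, stated for the operators acting on Schwartz space. -/
lemma norm_sub_laplacian_toL2_le {ω : ℝ} (hω : 0 < ω) (f : SchwartzMap R3 ℂ)
    (h0 : ∀ x : R2, (∫ z : ℝ, f (x, z) * (hosc ω z : ℂ)) = 0) :
    ‖(f - (∂_{ex0} (∂_{ex0} f) + ∂_{ex1} (∂_{ex1} f) + ∂_{ez} (∂_{ez} f))).toLp 2
        (volume : Measure R3)‖ ≤
      3 * ‖((1 - ω) • f - (∂_{ex0} (∂_{ex0} f) + ∂_{ex1} (∂_{ex1} f) + ∂_{ez} (∂_{ez} f)) +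
        ω ^ 2 • mulZ (mulZ f)).toLp 2 (volume : Measure R3)‖ := by
  exact norm_sub_laplacian_le_of_gap
    (SchwartzMap.toLpCLM ℝ ℂ 2 (volume : Measure R3)).toLinearMap
    (lineDerivOpCLM ℝ (SchwartzMap R3 ℂ) ex0).toLinearMap
    (lineDerivOpCLM ℝ (SchwartzMap R3 ℂ) ex1).toLinearMap
    (lineDerivOpCLM ℝ (SchwartzMap R3 ℂ) ez).toLinearMap mulZ.toLinearMap
    (SchwartzMap.real_inner_toL2_lineDerivOp volume ex0)
    (SchwartzMap.real_inner_toL2_lineDerivOp volume ex1)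
    (SchwartzMap.real_inner_toL2_lineDerivOp volume ez)
    real_inner_toL2_mulZ
    (fun u => (lineDerivOp_mulZ ex0 u).trans (by simp [ex0]))
    (fun u => (lineDerivOp_mulZ ex1 u).trans (by simp [ex1]))
    (fun u => (lineDerivOp_mulZ ez u).trans (by simp [ez]))
    hω.le f (schwartz_gap hω f h0)

end

/-- there is `C > 0` such that for every `ω ≥ 1` and every Schwartz
function `f` on ℝ³ orthogonal (in z) to the ground state `h_ω`,
`‖f − Δf‖_{L²} ≤ C ‖S²f‖_{L²}`. -/
theorem H2_bound_on_excited_states :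
    ∃ C : ℝ, 0 < C ∧ ∀ ω : ℝ, 1 ≤ ω → ∀ f : SchwartzMap R3 ℂ,
      (∀ x : R2, (∫ z : ℝ, f (x, z) * (hosc ω z : ℂ)) = 0) →
      (eLpNorm (fun p : R3 => f p - lap3 (⇑f) p) 2 volume).toReal ≤
        C * (eLpNorm (S2op ω (⇑f)) 2 volume).toReal := by
  refine ⟨3, by norm_num, fun ω hω f h0 => ?_⟩
  have key := norm_sub_laplacian_toL2_le (by linarith : 0 < ω) f h0
  rw [SchwartzMap.norm_toLp, SchwartzMap.norm_toLp] at key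
  have hlap (p : R3) : lap3 f p = LineDeriv.lineDerivOp ex0 (LineDeriv.lineDerivOp ex0 f) p +
      LineDeriv.lineDerivOp ex1 (LineDeriv.lineDerivOp ex1 f) p +
      LineDeriv.lineDerivOp ez (LineDeriv.lineDerivOp ez f) p := rfl
  convert key using 4
  · simp [hlap]
  · funext p
    simp [S2op, hlap, mulZ_apply]
    ring
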